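/- Let α > 3 and c, γ > 0 be real constants, and let f : ℕ → ℝ satisfy f(n) → ∞, f(n) = o(n) and f(n) = o(n^{1/(α−2)}) as n → ∞. Let (m_i)_{i ≥ 1} be a sequence of positive reals with m_i = (1+o(1))·c·i^{−α}·γ^{i}·(2i)! as i → ∞. For n ∈ ℕ set I(n) := {(j,k,l) ∈ ℤ_{≥1}³ : j + k + l = n − 2, j ≥ f(n), k ≥ f(n)}. Then, as n → ∞, (324/m_n)·Σ_{(j,k,l) ∈ I(n)} ((2n−4)!/((2j)!·(2k)!·(2l)!))·m_j·m_k·m_l·j·k·l² = (1+o(1))·(9c/(2γ(α−2)))²·(1/(f(n)^{2(α−2)}·n²)). -/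

import Mathlib

open Filter

lemma aux_u_lim (p : ℝ) :
    Tendsto (fun j : ℕ => ((j : ℝ) ^ (-p) - ((j : ℝ) + 1) ^ (-p)) * (j : ℝ) ^ (p + 1))
      atTop (nhds p) := by
  have h1 : HasDerivAt (fun x : ℝ => (1 + x) ^ (-p)) (-p) 0 := by
    have h := ((hasDerivAt_id (0 : ℝ)).const_add 1).rpow_const (p := -p) (Or.inl (by norm_num))
    simpa using h
  rw [hasDerivAt_iff_tendsto_slope_zero] at h1
  have h2 : Tendsto (fun j : ℕ => ((j : ℝ))⁻¹) atTop (nhdsWithin 0 {0}ᶜ) := by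
    rw [tendsto_nhdsWithin_iff]
    refine ⟨tendsto_inv_atTop_nhds_zero_nat, ?_⟩
    filter_upwards [eventually_ge_atTop 1] with j hj
    have : (j : ℝ) ≠ 0 := by positivity
    simpa using this
  have h3 := (h1.comp h2).neg
  rw [neg_neg] at h3
  refine h3.congr' ?_
  filter_upwards [eventually_ge_atTop 1] with j hj
  have hj0 : (0 : ℝ) < j := by positivity
  have e1 : (j : ℝ) ^ (-p) * (j : ℝ) ^ (p + 1) = j := by
    rw [← Real.rpow_add hj0]; simp
  have e2 : ((j : ℝ) + 1) ^ (-p) * (j : ℝ) ^ (p + 1) = j * (1 + (j : ℝ)⁻¹) ^ (-p) := by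
    have : (j : ℝ) + 1 = j * (1 + (j : ℝ)⁻¹) := by field_simp
    rw [this, Real.mul_rpow hj0.le (by positivity)]
    calc _ = ((j : ℝ) ^ (-p) * (j : ℝ) ^ (p + 1)) * (1 + (j : ℝ)⁻¹) ^ (-p) := by ring
      _ = _ := by rw [e1]
  rw [sub_mul, e1, e2]
  simp
  ring

lemma aux_u_sum (p : ℝ) (hp : 0 < p) (N : ℕ) (hN : 1 ≤ N) :
    HasSum (fun j : ℕ => (((j + N : ℕ) : ℝ) ^ (-p) - (((j + N : ℕ) : ℝ) + 1) ^ (-p)))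
      ((N : ℝ) ^ (-p)) := by
  rw [hasSum_iff_tendsto_nat_of_nonneg]
  · have e : ∀ n : ℕ, ∑ j ∈ Finset.range n,
        (((j + N : ℕ) : ℝ) ^ (-p) - (((j + N : ℕ) : ℝ) + 1) ^ (-p)) =
        (N : ℝ) ^ (-p) - ((n + N : ℕ) : ℝ) ^ (-p) := by
      intro n
      have := Finset.sum_range_sub' (fun j : ℕ => ((j + N : ℕ) : ℝ) ^ (-p)) n
      simp only [Nat.zero_add] at this
      rw [← this]
      refine Finset.sum_congr rfl fun j _ => ?_
      push_cast
      ring_nf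
    simp_rw [e]
    have h1 : Tendsto (fun n : ℕ => ((n + N : ℕ) : ℝ) ^ (-p)) atTop (nhds 0) :=
      (tendsto_rpow_neg_atTop hp).comp
        (tendsto_natCast_atTop_atTop.comp (tendsto_add_atTop_nat N))
    simpa using h1.const_sub ((N : ℝ) ^ (-p))
  · intro j
    have : (0 : ℝ) < ((j + N : ℕ) : ℝ) := by positivity
    rw [sub_nonneg]
    exact Real.rpow_le_rpow_of_nonpos this (by linarith) (by linarith)

lemma aux_tail (b : ℕ → ℝ) (hb : ∀ j, 0 ≤ b j) (p c : ℝ) (hp : 0 < p)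
    (h : Tendsto (fun j : ℕ => b j * (j : ℝ) ^ (p + 1)) atTop (nhds c)) :
    Summable b ∧
    Tendsto (fun N : ℕ => (∑' j, b (j + N)) * (N : ℝ) ^ p) atTop (nhds (c / p)) := by
  set u : ℕ → ℝ := fun j => (j : ℝ) ^ (-p) - ((j : ℝ) + 1) ^ (-p) with hu
  have hupos : ∀ j : ℕ, 1 ≤ j → 0 < u j := by
    intro j hj
    have : (0 : ℝ) < (j : ℝ) := by positivity
    simp only [hu]
    rw [sub_pos]
    exact Real.rpow_lt_rpow_of_neg this (by linarith) (by linarith)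
  have hr : Tendsto (fun j => b j / u j) atTop (nhds (c / p)) := by
    refine (h.div (aux_u_lim p) hp.ne').congr' ?_
    filter_upwards [eventually_ge_atTop 1] with j hj
    have : (0 : ℝ) < (j : ℝ) := by positivity
    have : (j : ℝ) ^ (p + 1) ≠ 0 := by positivity
    exact mul_div_mul_right _ _ this
  have key : ∀ ε > 0, ∃ J : ℕ, 1 ≤ J ∧ ∀ j ≥ J, (c / p - ε) * u j ≤ b j ∧
      b j ≤ (c / p + ε) * u j := by
    intro ε hε
    have := (Metric.tendsto_atTop.1 hr) ε hε
    obtain ⟨J, hJ⟩ := this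
    refine ⟨max J 1, le_max_right _ _, fun j hj => ?_⟩
    have h1 := hJ j (le_trans (le_max_left _ _) hj)
    have h2 := hupos j (le_trans (le_max_right _ _) hj)
    rw [Real.dist_eq, abs_lt] at h1
    rw [← le_div_iff₀ h2, ← div_le_iff₀ h2]
    constructor <;> linarith [h1.1, h1.2]
  have hsum : Summable b := by
    obtain ⟨J, hJ1, hJ⟩ := key 1 one_pos
    rw [← summable_nat_add_iff J]
    refine Summable.of_nonneg_of_le (fun j => hb _) (fun j => (hJ (j + J) (by omega)).2) ?_
    exact (aux_u_sum p hp J hJ1).summable.mul_left _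
  refine ⟨hsum, ?_⟩
  rw [Metric.tendsto_atTop]
  intro ε hε
  obtain ⟨J, hJ1, hJ⟩ := key (ε / 2) (half_pos hε)
  refine ⟨J, fun N hN => ?_⟩
  have hs := aux_u_sum p hp N (hJ1.trans hN)
  have hbs : Summable (fun j => b (j + N)) := (summable_nat_add_iff N).2 hsum
  have h1 : (c / p - ε / 2) * (N : ℝ) ^ (-p) ≤ ∑' j, b (j + N) := by
    rw [← (hs.mul_left (c / p - ε / 2)).tsum_eq]
    exact (hs.mul_left _).summable.tsum_le_tsum (fun j => (hJ (j + N) (by omega)).1) hbs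
  have h2 : ∑' j, b (j + N) ≤ (c / p + ε / 2) * (N : ℝ) ^ (-p) := by
    rw [← (hs.mul_left (c / p + ε / 2)).tsum_eq]
    exact hbs.tsum_le_tsum (fun j => (hJ (j + N) (by omega)).2) (hs.mul_left _).summable
  have hN0 : (0 : ℝ) < N := by have := hJ1.trans hN; positivity
  have hp0 : (0 : ℝ) < (N : ℝ) ^ p := by positivity
  rw [Real.rpow_neg hN0.le, ← div_eq_mul_inv] at h1 h2
  rw [div_le_iff₀ hp0] at h1
  rw [le_div_iff₀ hp0] at h2
  rw [Real.dist_eq, abs_lt]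
  constructor <;> linarith

/-- finite window sums below the tail -/
lemma aux_window (b : ℕ → ℝ) (hs : Summable b) (N M : ℕ) (h : N ≤ M) :
    ∑ j ∈ Finset.Ico N M, b j = (∑' j, b (j + N)) - ∑' j, b (j + M) := by
  have h1 := hs.sum_add_tsum_nat_add N
  have h2 := hs.sum_add_tsum_nat_add M
  rw [Finset.sum_Ico_eq_sub _ h]
  linarith

lemma aux_window_le (b : ℕ → ℝ) (hb : ∀ j, 0 ≤ b j) (hs : Summable b) (N M : ℕ) :
    ∑ j ∈ Finset.Ico N M, b j ≤ (∑' j, b (j + N)) := by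
  rcases le_total N M with h | h
  · rw [aux_window b hs N M h]
    have : 0 ≤ ∑' j, b (j + M) := tsum_nonneg fun j => hb _
    linarith
  · rw [Finset.Ico_eq_empty_of_le h]
    exact tsum_nonneg fun j => hb _

lemma aux_conv_le (d : ℕ → ℝ) (hd : ∀ j, 0 ≤ d j) (hs : Summable d) (n k N M : ℕ) :
    ∑ j ∈ Finset.Ico N M, (if j + k + 3 ≤ n then d (n - 2 - j - k) else 0) ≤ ∑' l, d l := by
  rw [← Finset.sum_filter]
  have : ∑ j ∈ (Finset.Ico N M).filter (fun j => j + k + 3 ≤ n), d (n - 2 - j - k) =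
      ∑ l ∈ ((Finset.Ico N M).filter (fun j => j + k + 3 ≤ n)).image (fun j => n - 2 - j - k),
        d l := by
    rw [Finset.sum_image]
    intro x hx y hy hxy
    simp at hx hy hxy
    omega
  rw [this]
  exact hs.sum_le_tsum _ (fun l _ => hd l)

/-- the reduced double sum -/
noncomputable def auxS (b d : ℕ → ℝ) (g : ℕ → ℕ) (n : ℕ) : ℝ :=
  ∑ j ∈ Finset.Ico (g n) n, ∑ k ∈ Finset.Ico (g n) n,
    if j + k + 3 ≤ n then b j * b k * d (n - 2 - j - k) else 0

lemma auxS_upper (b d : ℕ → ℝ) (hb : ∀ j, 0 ≤ b j) (hd : ∀ j, 0 ≤ d j) (hbs : Summable b)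
    (hds : Summable d) (g : ℕ → ℕ) (n : ℕ) (A B X : ℝ) (hA : 0 ≤ A) (hB : 0 ≤ B)
    (hX : ∀ j k, g n ≤ j → g n ≤ k → j + k + 3 ≤ n →
      X * (b j * b k * d (n - 2 - j - k)) ≤ A * (b j * b k) +
        B * (b j * d (n - 2 - j - k) + b k * d (n - 2 - j - k))) :
    X * auxS b d g n ≤ A * (∑' j, b (j + g n)) ^ 2 +
      2 * B * ((∑' j, b (j + g n)) * ∑' l, d l) := by
  have h1 : X * auxS b d g n ≤ ∑ j ∈ Finset.Ico (g n) n, ∑ k ∈ Finset.Ico (g n) n,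
      (A * (b j * b k) + (B * (b j * (if k + j + 3 ≤ n then d (n - 2 - k - j) else 0)) +
        B * (b k * (if j + k + 3 ≤ n then d (n - 2 - j - k) else 0)))) := by
    unfold auxS
    rw [Finset.mul_sum]
    refine Finset.sum_le_sum fun j hj => ?_
    rw [Finset.mul_sum]
    refine Finset.sum_le_sum fun k hk => ?_
    rw [Finset.mem_Ico] at hj hk
    have e : n - 2 - k - j = n - 2 - j - k := by omega
    rw [e, add_comm k j]
    split_ifs with h
    · have := hX j k hj.1 hk.1 h
      linarith
    · have := hb j; have := hb k
      simp only [mul_zero, add_zero]; positivity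
  refine h1.trans ?_
  simp_rw [Finset.sum_add_distrib]
  have hW := aux_window_le b hb hbs (g n) n
  have hW0 : 0 ≤ ∑ j ∈ Finset.Ico (g n) n, b j := Finset.sum_nonneg fun j _ => hb j
  have hD0 : 0 ≤ ∑' l, d l := tsum_nonneg hd
  set T := ∑' j, b (j + g n)
  have hT0 : 0 ≤ T := hW0.trans hW
  have p1 : ∑ j ∈ Finset.Ico (g n) n, ∑ k ∈ Finset.Ico (g n) n, A * (b j * b k) ≤ A * T ^ 2 := by
    simp_rw [← Finset.mul_sum]
    rw [← Finset.sum_mul]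
    rw [sq]
    gcongr
  have p2 : ∑ j ∈ Finset.Ico (g n) n, ∑ k ∈ Finset.Ico (g n) n,
      B * (b j * (if k + j + 3 ≤ n then d (n - 2 - k - j) else 0)) ≤ B * (T * ∑' l, d l) := by
    simp_rw [← Finset.mul_sum]
    refine mul_le_mul_of_nonneg_left ?_ hB
    calc _ ≤ ∑ j ∈ Finset.Ico (g n) n, b j * ∑' l, d l :=
          Finset.sum_le_sum fun j _ =>
            mul_le_mul_of_nonneg_left (aux_conv_le d hd hds n j _ _) (hb j)
      _ ≤ _ := by rw [← Finset.sum_mul]; gcongr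
  have p3 : ∑ j ∈ Finset.Ico (g n) n, ∑ k ∈ Finset.Ico (g n) n,
      B * (b k * (if j + k + 3 ≤ n then d (n - 2 - j - k) else 0)) ≤ B * (T * ∑' l, d l) := by
    rw [Finset.sum_comm]
    exact p2
  linarith

lemma auxS_lower (b d : ℕ → ℝ) (hb : ∀ j, 0 ≤ b j) (hd : ∀ j, 0 ≤ d j) (hbs : Summable b)
    (g : ℕ → ℕ) (n M : ℕ) (hM : 2 * M + 3 ≤ n) (hg : g n ≤ M) (A X : ℝ) (hX0 : 0 ≤ X)
    (hX : ∀ j k, j < M → k < M → A ≤ X * d (n - 2 - j - k)) :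
    A * ((∑' j, b (j + g n)) - ∑' j, b (j + M)) ^ 2 ≤ X * auxS b d g n := by
  rw [← aux_window b hbs _ _ hg, sq, Finset.sum_mul_sum]
  unfold auxS
  rw [Finset.mul_sum, Finset.mul_sum]
  have hnn : ∀ j k : ℕ, 0 ≤ (if j + k + 3 ≤ n then b j * b k * d (n - 2 - j - k) else 0) := by
    intro j k
    have := hb j; have := hb k; have := hd (n - 2 - j - k)
    split_ifs <;> positivity
  have hsub : Finset.Ico (g n) M ⊆ Finset.Ico (g n) n := Finset.Ico_subset_Ico le_rfl (by omega)
  refine le_trans ?_ (Finset.sum_le_sum_of_subset_of_nonneg hsub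
    fun j _ _ => mul_nonneg hX0 (Finset.sum_nonneg fun k _ => hnn j k))
  refine Finset.sum_le_sum fun j hj => ?_
  rw [Finset.mul_sum, Finset.mul_sum]
  refine le_trans ?_ (Finset.sum_le_sum_of_subset_of_nonneg hsub
    fun k _ _ => mul_nonneg hX0 (hnn j k))
  refine Finset.sum_le_sum fun k hk => ?_
  rw [Finset.mem_Ico] at hj hk
  rw [if_pos (by omega)]
  have := mul_le_mul_of_nonneg_right (hX j k hj.2 hk.2) (mul_nonneg (hb j) (hb k))
  linarith

lemma auxS_lim_upper (b d : ℕ → ℝ) (hb : ∀ j, 0 ≤ b j) (hd : ∀ j, 0 ≤ d j)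
    (p c : ℝ) (hp : 1 < p) (hc : 0 < c)
    (h : Tendsto (fun j : ℕ => b j * (j : ℝ) ^ (p + 1)) atTop (nhds c))
    (h' : Tendsto (fun j : ℕ => d j * (j : ℝ) ^ p) atTop (nhds c))
    (g : ℕ → ℕ) (hg : Tendsto g atTop atTop)
    (hgp : Tendsto (fun n => (g n : ℝ) ^ p / (n : ℝ)) atTop (nhds 0))
    (δ : ℝ) (hδ : 0 < δ) (hδ' : δ < 1 / 4) (ε : ℝ) (hε : 0 < ε) :
    ∀ᶠ n : ℕ in atTop, (n : ℝ) ^ p * auxS b d g n * ((g n : ℝ) ^ p) ^ 2 <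
      (c + δ) * (1 - 3 * δ) ^ (-p) * (c / p) ^ 2 + ε := by
  obtain ⟨hbs, hbt⟩ := aux_tail b hb p c (by linarith) h
  obtain ⟨hds, -⟩ := aux_tail d hd (p - 1) c (by linarith) (by simpa using h')
  obtain ⟨C, hC⟩ := h.bddAbove_range
  have hC : ∀ j : ℕ, b j * (j : ℝ) ^ (p + 1) ≤ C := fun j => hC ⟨j, rfl⟩
  have hC0 : 0 ≤ C := le_trans (mul_nonneg (hb 0) (Real.rpow_nonneg (by simp) _)) (hC 0)
  set A := (c + δ) * (1 - 3 * δ) ^ (-p) with hA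
  set B := C * δ ^ (-(p + 1)) with hB
  have hδ3 : 0 < 1 - 3 * δ := by linarith
  have hA0 : 0 ≤ A := by positivity
  have hB0 : 0 ≤ B := by positivity
  have hT := hbt.comp hg
  have hlim : Tendsto (fun n => A * ((∑' j, b (j + g n)) * (g n : ℝ) ^ p) ^ 2 +
      2 * B * (((∑' j, b (j + g n)) * (g n : ℝ) ^ p) * (∑' l, d l)) * ((g n : ℝ) ^ p / n))
      atTop (nhds (A * (c / p) ^ 2)) := by
    have := ((hT.pow 2).const_mul A).add (((hT.mul_const (∑' l, d l)).const_mul (2 * B)).mul hgp)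
    simpa using this
  have hev := hlim.eventually_lt_const (show A * (c / p) ^ 2 < A * (c / p) ^ 2 + ε by linarith)
  have hL := h'.eventually_lt_const (show c < c + δ by linarith)
  obtain ⟨L, hL⟩ := eventually_atTop.1 hL
  have e1 : ∀ᶠ n : ℕ in atTop, 2 ≤ δ * (n : ℝ) :=
    (tendsto_natCast_atTop_atTop.const_mul_atTop hδ).eventually_ge_atTop 2
  have e2 : ∀ᶠ n : ℕ in atTop, (L : ℝ) ≤ (1 - 3 * δ) * (n : ℝ) :=
    (tendsto_natCast_atTop_atTop.const_mul_atTop hδ3).eventually_ge_atTop _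
  filter_upwards [hev, e1, e2, eventually_ge_atTop 1] with n hn h1 h2 h3
  refine lt_of_le_of_lt ?_ hn
  have hn0 : (0 : ℝ) < n := by positivity
  have hbig : ∀ j : ℕ, δ * n < j → (n : ℝ) ^ p * b j ≤ B / n := by
    intro j hj
    have q1 : (δ * n) ^ (p + 1) ≤ (j : ℝ) ^ (p + 1) :=
      Real.rpow_le_rpow (by positivity) hj.le (by linarith)
    have q2 : b j * (δ * n) ^ (p + 1) ≤ C :=
      (mul_le_mul_of_nonneg_left q1 (hb j)).trans (hC j)
    rw [Real.mul_rpow hδ.le hn0.le, Real.rpow_add_one hn0.ne'] at q2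
    rw [le_div_iff₀ hn0, hB, Real.rpow_neg hδ.le, ← div_eq_mul_inv, le_div_iff₀ (by positivity)]
    linarith
  have main := auxS_upper b d hb hd hbs hds g n A (B / n) ((n : ℝ) ^ p) hA0 (by positivity) ?_
  · calc _ ≤ (A * (∑' j, b (j + g n)) ^ 2 +
      2 * (B / n) * ((∑' j, b (j + g n)) * ∑' l, d l)) * ((g n : ℝ) ^ p) ^ 2 :=
          mul_le_mul_of_nonneg_right main (by positivity)
      _ = _ := by ring
  · intro j k _ _ hjk
    have b1 := hb j
    have b2 := hb k
    have d1 := hd (n - 2 - j - k)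
    by_cases hj : δ * n < j
    · have := mul_le_mul_of_nonneg_right (hbig j hj) (mul_nonneg b2 d1)
      have t1 : 0 ≤ A * (b j * b k) := by positivity
      have t2 : 0 ≤ B / n * (b j * d (n - 2 - j - k)) := by positivity
      linarith
    by_cases hk : δ * n < k
    · have := mul_le_mul_of_nonneg_right (hbig k hk) (mul_nonneg b1 d1)
      have t1 : 0 ≤ A * (b j * b k) := by positivity
      have t2 : 0 ≤ B / n * (b k * d (n - 2 - j - k)) := by positivity
      linarith
    push Not at hj hk
    have t2 : 0 ≤ B / n * (b j * d (n - 2 - j - k) + b k * d (n - 2 - j - k)) := by positivity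
    obtain ⟨l, hl⟩ : ∃ l, l = n - 2 - j - k := ⟨_, rfl⟩
    rw [← hl] at d1 t2 ⊢
    have hlr : (l : ℝ) = n - 2 - j - k := by
      have : l + 2 + j + k = n := by omega
      rw [← this]; push_cast; ring
    have hl1 : (1 - 3 * δ) * n ≤ (l : ℝ) := by rw [hlr]; linarith
    have hl2 : L ≤ l := by exact_mod_cast h2.trans hl1
    have hl3 := (hL l hl2).le
    have q1 : ((1 - 3 * δ) * n) ^ p ≤ (l : ℝ) ^ p :=
      Real.rpow_le_rpow (by positivity) hl1 (by linarith)
    have q2 := (mul_le_mul_of_nonneg_left q1 d1).trans hl3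
    rw [Real.mul_rpow hδ3.le hn0.le] at q2
    have q3 : (n : ℝ) ^ p * d l ≤ A := by
      rw [hA, Real.rpow_neg hδ3.le, ← div_eq_mul_inv, le_div_iff₀ (by positivity)]
      linarith
    have := mul_le_mul_of_nonneg_right q3 (mul_nonneg b1 b2)
    linarith

lemma auxS_lim_lower (b d : ℕ → ℝ) (hb : ∀ j, 0 ≤ b j) (hd : ∀ j, 0 ≤ d j)
    (p c : ℝ) (hp : 1 < p) (hc : 0 < c)
    (h : Tendsto (fun j : ℕ => b j * (j : ℝ) ^ (p + 1)) atTop (nhds c))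
    (h' : Tendsto (fun j : ℕ => d j * (j : ℝ) ^ p) atTop (nhds c))
    (g : ℕ → ℕ) (hg : Tendsto g atTop atTop)
    (hgn : Tendsto (fun n => (g n : ℝ) / (n : ℝ)) atTop (nhds 0))
    (δ : ℝ) (hδ : 0 < δ) (ε : ℝ) (hε : 0 < ε) :
    ∀ᶠ n : ℕ in atTop, (c - δ) * (c / p) ^ 2 - ε <
      (n : ℝ) ^ p * auxS b d g n * ((g n : ℝ) ^ p) ^ 2 := by
  obtain ⟨hbs, hbt⟩ := aux_tail b hb p c (by linarith) h
  have hT := hbt.comp hg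
  have hM : Tendsto (fun n : ℕ => n / 4) atTop atTop :=
    Nat.tendsto_div_const_atTop (by norm_num)
  have hTM := hbt.comp hM
  have hgM : Tendsto (fun n : ℕ => (g n : ℝ) / ((n / 4 : ℕ) : ℝ)) atTop (nhds 0) := by
    have h8 := hgn.const_mul 8
    rw [mul_zero] at h8
    refine squeeze_zero' (Eventually.of_forall fun n => by positivity) ?_ h8
    filter_upwards [eventually_ge_atTop 8] with n hn
    have q : (n : ℝ) ≤ 8 * ((n / 4 : ℕ) : ℝ) := by
      have : n ≤ 8 * (n / 4) := by omega
      exact_mod_cast this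
    have hn0 : (0 : ℝ) < n := by positivity
    have hm0 : (0 : ℝ) < ((n / 4 : ℕ) : ℝ) := by linarith
    rw [mul_div_assoc', div_le_div_iff₀ hm0 hn0]
    have := mul_le_mul_of_nonneg_left q (Nat.cast_nonneg (α := ℝ) (g n))
    linarith
  have hgMp : Tendsto (fun n : ℕ => ((g n : ℝ) / ((n / 4 : ℕ) : ℝ)) ^ p) atTop (nhds 0) := by
    have := hgM.rpow_const (p := p) (Or.inr (by linarith))
    rwa [Real.zero_rpow (by linarith)] at this
  have hT2 : Tendsto (fun n => (∑' j, b (j + n / 4)) * (g n : ℝ) ^ p) atTop (nhds 0) := by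
    have := hTM.mul hgMp
    rw [mul_zero] at this
    refine this.congr' ?_
    filter_upwards [eventually_ge_atTop 4] with n hn
    have hm0 : (0 : ℝ) < ((n / 4 : ℕ) : ℝ) := by
      have : 0 < n / 4 := by omega
      exact_mod_cast this
    have hmp : 0 < ((n / 4 : ℕ) : ℝ) ^ p := by positivity
    simp only [Function.comp]
    rw [Real.div_rpow (by positivity) hm0.le]
    field_simp
  have hlim : Tendsto (fun n => (c - δ) * ((∑' j, b (j + g n)) * (g n : ℝ) ^ p -
      (∑' j, b (j + n / 4)) * (g n : ℝ) ^ p) ^ 2) atTop (nhds ((c - δ) * (c / p) ^ 2)) := by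
    have := ((hT.sub hT2).pow 2).const_mul (c - δ)
    simpa using this
  have hev := hlim.eventually_const_lt
    (show (c - δ) * (c / p) ^ 2 - ε < (c - δ) * (c / p) ^ 2 by linarith)
  have hL := h'.eventually_const_lt (show c - δ < c by linarith)
  obtain ⟨L, hL⟩ := eventually_atTop.1 hL
  have hg1 := hgM.eventually_lt_const (show (0 : ℝ) < 1 by norm_num)
  filter_upwards [hev, hg1, eventually_ge_atTop (2 * L + 12)] with n hn h1 h2
  refine lt_of_lt_of_le hn ?_
  have hm0 : (0 : ℝ) < ((n / 4 : ℕ) : ℝ) := by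
    have : 0 < n / 4 := by omega
    exact_mod_cast this
  rw [div_lt_one hm0] at h1
  have h1 : g n ≤ n / 4 := by exact_mod_cast h1.le
  have main := auxS_lower b d hb hd hbs g n (n / 4) (by omega) h1 (c - δ) ((n : ℝ) ^ p)
    (by positivity) ?_
  · calc _ = ((c - δ) * ((∑' j, b (j + g n)) - ∑' j, b (j + n / 4)) ^ 2) *
          ((g n : ℝ) ^ p) ^ 2 := by ring
      _ ≤ _ := mul_le_mul_of_nonneg_right main (by positivity)
  · intro j k hj hk
    have := hL (n - 2 - j - k) (by omega)
    refine this.le.trans ?_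
    rw [mul_comm]
    refine mul_le_mul_of_nonneg_right ?_ (hd _)
    refine Real.rpow_le_rpow (by positivity) ?_ (by linarith)
    have : n - 2 - j - k ≤ n := by omega
    exact_mod_cast this

lemma auxS_lim (b d : ℕ → ℝ) (hb : ∀ j, 0 ≤ b j) (hd : ∀ j, 0 ≤ d j)
    (p c : ℝ) (hp : 1 < p) (hc : 0 < c)
    (h : Tendsto (fun j : ℕ => b j * (j : ℝ) ^ (p + 1)) atTop (nhds c))
    (h' : Tendsto (fun j : ℕ => d j * (j : ℝ) ^ p) atTop (nhds c))
    (g : ℕ → ℕ) (hg : Tendsto g atTop atTop)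
    (hgn : Tendsto (fun n => (g n : ℝ) / (n : ℝ)) atTop (nhds 0))
    (hgp : Tendsto (fun n => (g n : ℝ) ^ p / (n : ℝ)) atTop (nhds 0)) :
    Tendsto (fun n : ℕ => (n : ℝ) ^ p * auxS b d g n * ((g n : ℝ) ^ p) ^ 2) atTop
      (nhds (c * (c / p) ^ 2)) := by
  rw [tendsto_order]
  constructor
  · intro a ha
    have hcont : Tendsto (fun δ : ℝ => (c - δ) * (c / p) ^ 2 - δ) (nhdsWithin 0 (Set.Ioi 0))
        (nhds (c * (c / p) ^ 2)) := by
      have : Continuous (fun δ : ℝ => (c - δ) * (c / p) ^ 2 - δ) := by fun_prop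
      have := this.tendsto 0
      simp only [sub_zero] at this
      exact this.mono_left nhdsWithin_le_nhds
    obtain ⟨δ, hδa, hδ⟩ := ((hcont.eventually_const_lt ha).and self_mem_nhdsWithin).exists
    filter_upwards [auxS_lim_lower b d hb hd p c hp hc h h' g hg hgn δ hδ δ hδ] with n hn
    exact hδa.trans hn
  · intro a ha
    have hcont : Tendsto (fun δ : ℝ => (c + δ) * (1 - 3 * δ) ^ (-p) * (c / p) ^ 2 + δ)
        (nhdsWithin 0 (Set.Ioi 0)) (nhds (c * (c / p) ^ 2)) := by
      have : ContinuousAt (fun δ : ℝ => (c + δ) * (1 - 3 * δ) ^ (-p) * (c / p) ^ 2 + δ) 0 := by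
        have : ContinuousAt (fun δ : ℝ => (1 - 3 * δ) ^ (-p)) 0 :=
          ContinuousAt.rpow_const (by fun_prop) (Or.inl (by norm_num))
        fun_prop
      have := this.tendsto
      simp only [add_zero, mul_zero, sub_zero, Real.one_rpow, mul_one] at this
      exact this.mono_left nhdsWithin_le_nhds
    obtain ⟨δ, ⟨hδa, hδ⟩, hδ4⟩ := (((hcont.eventually_lt_const ha).and self_mem_nhdsWithin).and
      (nhdsWithin_le_nhds (eventually_lt_nhds (show (0 : ℝ) < 1 / 4 by norm_num)))).exists
    filter_upwards [auxS_lim_upper b d hb hd p c hp hc h h' g hg hgp δ hδ hδ4 δ hδ] with n hn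
    exact hn.trans hδa

lemma aux_fact_lim : Tendsto (fun n : ℕ => 16 * (n : ℝ) ^ 4 * (Nat.factorial (2 * n - 4) : ℝ) /
    (Nat.factorial (2 * n) : ℝ)) atTop (nhds 1) := by
  have h0 : Tendsto (fun n : ℕ => (n : ℝ)⁻¹) atTop (nhds 0) := tendsto_inv_atTop_nhds_zero_nat
  have hcont : ContinuousAt (fun x : ℝ => 1 / ((1 - x / 2) * (1 - x) * (1 - 3 * x / 2))) 0 := by
    refine ContinuousAt.div (by fun_prop) (by fun_prop) (by norm_num)
  have h1 := hcont.tendsto.comp h0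
  norm_num at h1
  refine Tendsto.congr' ?_ h1
  filter_upwards [eventually_ge_atTop 2] with n hn
  obtain ⟨k, rfl⟩ : ∃ k, n = k + 2 := ⟨n - 2, by omega⟩
  have e1 : 2 * (k + 2) - 4 = 2 * k := by omega
  have e2 : 2 * (k + 2) = 2 * k + 1 + 1 + 1 + 1 := by ring
  rw [e1, e2]
  have hf : (Nat.factorial (2 * k) : ℝ) ≠ 0 := by positivity
  simp only [Nat.factorial_succ, Function.comp]
  push_cast
  have hk : (0 : ℝ) ≤ k := by positivity
  have : (k : ℝ) + 2 ≠ 0 := by positivity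
  have : (k : ℝ) + 1 ≠ 0 := by positivity
  have : 2 * (k : ℝ) + 1 ≠ 0 := by positivity
  have : 2 * (k : ℝ) + 3 ≠ 0 := by positivity
  have q1 : 1 - ((k : ℝ) + 2)⁻¹ / 2 = (2 * k + 3) / (2 * (k + 2)) := by field_simp; ring
  have q2 : 1 - ((k : ℝ) + 2)⁻¹ = (k + 1) / (k + 2) := by field_simp; ring
  have q3 : 1 - 3 * ((k : ℝ) + 2)⁻¹ / 2 = (2 * k + 1) / (2 * (k + 2)) := by field_simp; ring
  have r1 : 2 * (k : ℝ) + 3 + 1 = 2 * (k + 2) := by ring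
  have r2 : 2 * (k : ℝ) + 2 + 1 = 2 * k + 3 := by ring
  have r3 : 2 * (k : ℝ) + 1 + 1 = 2 * (k + 1) := by ring
  rw [q1, q2, q3, r1, r2, r3]
  field_simp
  try norm_num

lemma aux_sum_eq (γ : ℝ) (hγ : 0 < γ) (m : ℕ → ℝ) (x : ℝ) (hx : 0 < x) (n : ℕ) (g : ℕ → ℕ)
    (hg : g n = ⌈x⌉₊) (hn : 2 ≤ n) :
    ∑ t ∈ (Finset.range n ×ˢ Finset.range n ×ˢ Finset.range n).filter
            (fun t => t.1 + t.2.1 + t.2.2 = n - 2 ∧ 1 ≤ t.1 ∧ 1 ≤ t.2.1 ∧ 1 ≤ t.2.2 ∧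
              x ≤ (t.1 : ℝ) ∧ x ≤ (t.2.1 : ℝ)),
          ((Nat.factorial (2 * n - 4) : ℝ) /
              ((Nat.factorial (2 * t.1) : ℝ) * (Nat.factorial (2 * t.2.1) : ℝ) *
                (Nat.factorial (2 * t.2.2) : ℝ))) *
            m t.1 * m t.2.1 * m t.2.2 * (t.1 : ℝ) * (t.2.1 : ℝ) * (t.2.2 : ℝ) ^ 2 =
    (Nat.factorial (2 * n - 4) : ℝ) * γ ^ (n - 2) *
      auxS (fun j => m j / (γ ^ j * (Nat.factorial (2 * j) : ℝ)) * j)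
        (fun j => m j / (γ ^ j * (Nat.factorial (2 * j) : ℝ)) * (j : ℝ) ^ 2) g n := by
  have hN : 1 ≤ ⌈x⌉₊ := Nat.one_le_ceil_iff.2 hx
  unfold auxS
  rw [hg, ← Finset.sum_product', ← Finset.sum_filter, Finset.mul_sum]
  refine Finset.sum_nbij' (fun t => (t.1, t.2.1)) (fun t => (t.1, t.2, n - 2 - t.1 - t.2))
    ?_ ?_ ?_ ?_ ?_
  · rintro ⟨j, k, l⟩ h
    simp only [Finset.mem_filter, Finset.mem_product, Finset.mem_range, Finset.mem_Ico,
      Nat.ceil_le] at h ⊢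
    obtain ⟨⟨h1, h2, h3⟩, h4, h5, h6, h7, h8, h9⟩ := h
    exact ⟨⟨⟨h8, h1⟩, h9, h2⟩, by omega⟩
  · rintro ⟨j, k⟩ h
    simp only [Finset.mem_filter, Finset.mem_product, Finset.mem_range, Finset.mem_Ico] at h ⊢
    obtain ⟨⟨⟨h1, h2⟩, h3, h4⟩, h5⟩ := h
    exact ⟨⟨h2, h4, by omega⟩, by omega, by omega, by omega, by omega,
      Nat.ceil_le.1 h1, Nat.ceil_le.1 h3⟩
  · rintro ⟨j, k, l⟩ h
    simp only [Finset.mem_filter, Finset.mem_product, Finset.mem_range] at h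
    simp only [Prod.mk.injEq, true_and]
    omega
  · rintro ⟨j, k⟩ h
    rfl
  · rintro ⟨j, k, l⟩ h
    simp only [Finset.mem_filter, Finset.mem_product, Finset.mem_range] at h
    have hl : n - 2 - j - k = l := by omega
    have hl2 : n - 2 = j + k + l := by omega
    simp only []
    rw [hl, hl2, pow_add, pow_add]
    have h1 : (Nat.factorial (2 * j) : ℝ) ≠ 0 := by positivity
    have h2 : (Nat.factorial (2 * k) : ℝ) ≠ 0 := by positivity
    have h3 : (Nat.factorial (2 * l) : ℝ) ≠ 0 := by positivity
    field_simp

theorem bridge_double_sum_asymptotics (α c γ : ℝ) (hα : 3 < α) (hc : 0 < c) (hγ : 0 < γ)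
    (f : ℕ → ℝ) (hf : Tendsto f atTop atTop)
    (hfo : Tendsto (fun n => f n / (n : ℝ)) atTop (nhds 0))
    (hfo' : Tendsto (fun n => f n / (n : ℝ) ^ (1 / (α - 2))) atTop (nhds 0))
    (m : ℕ → ℝ) (hm : ∀ i, 1 ≤ i → 0 < m i)
    (hasy : Tendsto
      (fun i : ℕ => m i / (c * (i : ℝ) ^ (-α) * γ ^ i * (Nat.factorial (2 * i) : ℝ)))
      atTop (nhds 1)) :
    Tendsto (fun n : ℕ =>
        ((324 / m n) * ∑ t ∈ (Finset.range n ×ˢ Finset.range n ×ˢ Finset.range n).filter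
            (fun t => t.1 + t.2.1 + t.2.2 = n - 2 ∧ 1 ≤ t.1 ∧ 1 ≤ t.2.1 ∧ 1 ≤ t.2.2 ∧
              f n ≤ (t.1 : ℝ) ∧ f n ≤ (t.2.1 : ℝ)),
          ((Nat.factorial (2 * n - 4) : ℝ) /
              ((Nat.factorial (2 * t.1) : ℝ) * (Nat.factorial (2 * t.2.1) : ℝ) *
                (Nat.factorial (2 * t.2.2) : ℝ))) *
            m t.1 * m t.2.1 * m t.2.2 * (t.1 : ℝ) * (t.2.1 : ℝ) * (t.2.2 : ℝ) ^ 2) /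
        ((9 * c / (2 * γ * (α - 2))) ^ 2 * (1 / (f n ^ (2 * (α - 2)) * (n : ℝ) ^ 2))))
      atTop (nhds 1) := by
  obtain ⟨p, hp⟩ : ∃ p, p = α - 2 := ⟨_, rfl⟩
  have hp1 : 1 < p := by linarith
  have hp0 : 0 < p := by linarith
  have hαp : α = p + 2 := by linarith
  rw [← hp] at hfo' ⊢
  set a : ℕ → ℝ := fun j => m j / (γ ^ j * (Nat.factorial (2 * j) : ℝ)) with ha
  set b : ℕ → ℝ := fun j => m j / (γ ^ j * (Nat.factorial (2 * j) : ℝ)) * j with hb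
  set d : ℕ → ℝ := fun j => m j / (γ ^ j * (Nat.factorial (2 * j) : ℝ)) * (j : ℝ) ^ 2 with hd
  set g : ℕ → ℕ := fun n => ⌈f n⌉₊ with hg
  have hb0 : ∀ j, 0 ≤ b j := by
    intro j
    rcases Nat.eq_zero_or_pos j with rfl | hj
    · simp [hb]
    · have := hm j hj
      simp only [hb]; positivity
  have hd0 : ∀ j, 0 ≤ d j := by
    intro j
    rcases Nat.eq_zero_or_pos j with rfl | hj
    · simp [hd]
    · have := hm j hj
      simp only [hd]; positivity
  have haα : Tendsto (fun j : ℕ => a j * (j : ℝ) ^ α) atTop (nhds c) := by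
    have := hasy.mul_const c
    rw [one_mul] at this
    refine this.congr' ?_
    filter_upwards [eventually_ge_atTop 1] with j hj
    have hj0 : (0 : ℝ) < j := by positivity
    have : (j : ℝ) ^ α ≠ 0 := by positivity
    have hF : (Nat.factorial (2 * j) : ℝ) ≠ 0 := by positivity
    simp only [ha]
    rw [Real.rpow_neg hj0.le]
    field_simp
  have hbl : Tendsto (fun j : ℕ => b j * (j : ℝ) ^ (p + 1)) atTop (nhds c) := by
    refine haα.congr' ?_
    filter_upwards [eventually_ge_atTop 1] with j hj
    have hj0 : (0 : ℝ) < j := by positivity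
    have : (j : ℝ) ^ α = j * (j : ℝ) ^ (p + 1) := by
      rw [hαp, show p + 2 = (p + 1) + 1 by ring, Real.rpow_add_one hj0.ne' (p + 1), mul_comm]
    simp only [ha, hb]
    rw [this]; ring
  have hdl : Tendsto (fun j : ℕ => d j * (j : ℝ) ^ p) atTop (nhds c) := by
    refine haα.congr' ?_
    filter_upwards [eventually_ge_atTop 1] with j hj
    have hj0 : (0 : ℝ) < j := by positivity
    have : (j : ℝ) ^ α = (j : ℝ) ^ 2 * (j : ℝ) ^ p := by
      rw [hαp, Real.rpow_add hj0, mul_comm]; norm_cast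
    simp only [ha, hd]
    rw [this]; ring
  have hgt : Tendsto g atTop atTop := tendsto_nat_ceil_atTop.comp hf
  have hgf : Tendsto (fun n => (g n : ℝ) / f n) atTop (nhds 1) :=
    (tendsto_nat_ceil_div_atTop (R := ℝ)).comp hf
  have hgn : Tendsto (fun n => (g n : ℝ) / (n : ℝ)) atTop (nhds 0) := by
    have := hgf.mul hfo
    rw [mul_zero] at this
    refine this.congr' ?_
    filter_upwards [hf.eventually_gt_atTop 0] with n hn
    field_simp
  have hgp : Tendsto (fun n => (g n : ℝ) ^ p / (n : ℝ)) atTop (nhds 0) := by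
    have := (hgf.mul hfo').rpow_const (p := p) (Or.inr hp0.le)
    rw [mul_zero, Real.zero_rpow hp0.ne'] at this
    refine this.congr' ?_
    filter_upwards [hf.eventually_gt_atTop 0, eventually_ge_atTop 1] with n hn hn1
    have hn0 : (0 : ℝ) < n := by positivity
    have e : (g n : ℝ) / f n * (f n / (n : ℝ) ^ (1 / p)) = g n / (n : ℝ) ^ (1 / p) := by
      field_simp
    rw [e, Real.div_rpow (by positivity) (by positivity), ← Real.rpow_mul hn0.le,
      one_div_mul_cancel hp0.ne', Real.rpow_one]
  have hS := auxS_lim b d hb0 hd0 p c hp1 hc hbl hdl g hgt hgn hgp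
  have hgf2 : Tendsto (fun n => (((g n : ℝ) / f n) ^ p) ^ 2) atTop (nhds 1) := by
    have := (hgf.rpow_const (p := p) (Or.inr hp0.le)).pow 2
    simpa using this
  have hlim := ((aux_fact_lim.div hasy one_ne_zero).mul (hS.div hgf2 one_ne_zero)).mul_const
    (p ^ 2 / c ^ 3)
  have e1 : (1 : ℝ) / 1 * (c * (c / p) ^ 2 / 1) * (p ^ 2 / c ^ 3) = 1 := by field_simp
  rw [e1] at hlim
  refine hlim.congr' ?_
  filter_upwards [hf.eventually_gt_atTop 0, eventually_ge_atTop 2] with n hfn hn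
  rw [aux_sum_eq γ hγ m (f n) hfn n g rfl hn]
  change _ = 324 / m n * ((Nat.factorial (2 * n - 4) : ℝ) * γ ^ (n - 2) * auxS b d g n) / _
  obtain ⟨S, hSe⟩ : ∃ S, S = auxS b d g n := ⟨_, rfl⟩
  simp only [Pi.div_apply]
  rw [← hSe]
  have hn0 : (0 : ℝ) < n := by positivity
  have hmn := hm n (by omega)
  have hF : (Nat.factorial (2 * n) : ℝ) ≠ 0 := by positivity
  have hg0 : (0 : ℝ) < g n := by
    have : 0 < g n := Nat.ceil_pos.2 hfn
    exact_mod_cast this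
  have x1 : (n : ℝ) ^ (-α) = ((n : ℝ) ^ p * (n : ℝ) ^ 2)⁻¹ := by
    rw [Real.rpow_neg hn0.le, hαp, Real.rpow_add hn0]; norm_cast
  have x2 : f n ^ (2 * p) = (f n ^ p) ^ 2 := by
    rw [mul_comm, Real.rpow_mul hfn.le]; norm_cast
  have x3 : γ ^ n = γ ^ (n - 2) * γ ^ 2 := by
    rw [← pow_add]; congr 1; omega
  rw [x1, x2, x3, Real.div_rpow hg0.le hfn.le]
  have y1 : (n : ℝ) ^ p ≠ 0 := by positivity
  have y2 : (g n : ℝ) ^ p ≠ 0 := by positivity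
  have y3 : f n ^ p ≠ 0 := by positivity
  have y4 : γ ^ (n - 2) ≠ 0 := by positivity
  generalize (n : ℝ) ^ p = z1 at *
  generalize (g n : ℝ) ^ p = z2 at *
  generalize f n ^ p = z3 at *
  generalize γ ^ (n - 2) = z4 at *
  field_simp
  ring
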